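/- arXiv:1804.01088 — 4 statements merged into one kernel-verified Lean document; each statement's English description precedes it below -/
import Mathlib

section
/- For any finite simple connected graph G on n ≥ 3 vertices, tr(G) = 2n − 2 if and only if G is a tree with exactly 2 or exactly 3 leaves. -/
open Finset

/-- The triameter of a graph: the maximum of `d(u,v) + d(v,w) + d(u,w)` over all
triples of vertices. -/
noncomputable def SimpleGraph.triameter {V : Type*} [Fintype V] (G : SimpleGraph V) : ℕ :=
  Finset.univ.sup fun p : V × V × V =>
    G.dist p.1 p.2.1 + G.dist p.2.1 p.2.2 + G.dist p.1 p.2.2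

/-- The number of leaves (vertices of degree 1) of a graph. -/
def SimpleGraph.numLeaves {V : Type*} [Fintype V] [DecidableEq V] (G : SimpleGraph V)
    [DecidableRel G.Adj] : ℕ :=
  (Finset.univ.filter fun v => G.degree v = 1).card

namespace SimpleGraph

variable {V : Type*} {G : SimpleGraph V}

section Connected

variable {u v w x y m : V}

lemma Connected.exists_adj_dist_add_one_eq (hG : G.Connected) (h : x ≠ u) :
    ∃ y, G.Adj x y ∧ G.dist y u + 1 = G.dist x u := by
  obtain ⟨p, hp⟩ := hG.exists_walk_length_eq_dist x u
  cases p with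
  | nil => exact absurd rfl h
  | @cons _ y _ hxy q =>
    refine ⟨y, hxy, le_antisymm ?_ ?_⟩
    · rw [← hp, Walk.length_cons]
      exact Nat.add_le_add_right (dist_le q) 1
    · have := hG.dist_triangle (u := x) (v := y) (w := u)
      rw [dist_eq_one_iff_adj.2 hxy] at this
      lia

lemma Walk.dist_add_dist_of_mem_support {p : G.Walk u v} (hp : p.length = G.dist u v)
    (hx : x ∈ p.support) : G.dist u x + G.dist x v = G.dist u v := by
  classical
  have h := congrArg Walk.length (p.take_spec hx)
  rw [Walk.length_append] at h
  have h₁ := dist_le (p.takeUntil x hx)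
  have h₂ := dist_le (p.dropUntil x hx)
  have h₃ := (p.takeUntil x hx).reachable.dist_triangle_left v
  lia

lemma Walk.getVert_dist_eq_of_mem_support {p : G.Walk u v} (hp : p.length = G.dist u v)
    (hx : x ∈ p.support) : p.getVert (G.dist u x) = x := by
  classical
  have h := congrArg Walk.length (p.take_spec hx)
  rw [Walk.length_append] at h
  have h₁ := dist_le (p.takeUntil x hx)
  have h₂ := dist_le (p.dropUntil x hx)
  have h₃ := dist_add_dist_of_mem_support hp hx
  have h₄ : G.dist u x = (p.takeUntil x hx).length := by lia
  rw [h₄, p.getVert_length_takeUntil hx]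

lemma Walk.mk_mem_edges_of_adj_of_mem_support {p : G.Walk u v} (hp : p.length = G.dist u v)
    (hx : x ∈ p.support) (hy : y ∈ p.support) (hxy : G.Adj x y) : s(x, y) ∈ p.edges := by
  wlog hle : G.dist u x ≤ G.dist u y generalizing x y
  · rw [Sym2.eq_swap]
    exact this hy hx hxy.symm (le_of_not_ge hle)
  have hx' := getVert_dist_eq_of_mem_support hp hx
  have hy' := getVert_dist_eq_of_mem_support hp hy
  have hne : G.dist u x ≠ G.dist u y := fun h ↦ hxy.ne (by rw [← hx', ← hy', h])
  have hy₂ := dist_add_dist_of_mem_support hp hy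
  have hsucc : G.dist u y = G.dist u x + 1 := by
    have := hxy.diff_dist_adj (u := u)
    lia
  rw [Walk.edges_eq_map_darts]
  have hlt : G.dist u x < p.darts.length := by rw [p.length_darts]; lia
  refine List.mem_map.2 ⟨_, List.getElem_mem hlt, ?_⟩
  rw [p.darts_getElem_eq_getVert _ hlt, Dart.edge_mk, ← hsucc]
  simp [hx', hy']

lemma Connected.exists_walks_support_inter_eq (hG : G.Connected) (u v w : V) :
    ∃ (m : V) (p : G.Walk u v) (q : G.Walk m w), p.length = G.dist u v ∧
      q.length = G.dist m w ∧ m ∈ p.support ∧ ∀ x ∈ p.support, x ∈ q.support → x = m := by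
  classical
  obtain ⟨p, hp⟩ := hG.exists_walk_length_eq_dist u v
  obtain ⟨m, hm, hmin⟩ := p.support.toFinset.exists_min_image (fun x ↦ G.dist x w)
    ⟨u, by simp⟩
  obtain ⟨q, hq⟩ := hG.exists_walk_length_eq_dist m w
  refine ⟨m, p, q, hp, hq, by simpa using hm, fun x hx hxq ↦ ?_⟩
  have h₁ := hmin x (by simpa using hx)
  have h₂ := Walk.dist_add_dist_of_mem_support hq hxq
  have h₃ : G.dist m x = 0 := by lia
  exact (hG.dist_eq_zero_iff.1 h₃).symm

lemma Walk.card_support_union_add_one [DecidableEq V] {p : G.Walk u v} {q : G.Walk m w}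
    (hp : p.length = G.dist u v) (hq : q.length = G.dist m w) (hm : m ∈ p.support)
    (hpq : ∀ x ∈ p.support, x ∈ q.support → x = m) :
    (p.support.toFinset ∪ q.support.toFinset).card = G.dist u v + G.dist m w + 1 := by
  have hinter : p.support.toFinset ∩ q.support.toFinset = {m} := by
    ext x
    simp only [Finset.mem_inter, List.mem_toFinset, Finset.mem_singleton]
    exact ⟨fun h ↦ hpq x h.1 h.2, by rintro rfl; exact ⟨hm, q.start_mem_support⟩⟩
  have h := Finset.card_union_add_card_inter p.support.toFinset q.support.toFinset
  rw [hinter, Finset.card_singleton,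
    List.toFinset_card_of_nodup (p.isPath_of_length_eq_dist hp).support_nodup,
    List.toFinset_card_of_nodup (q.isPath_of_length_eq_dist hq).support_nodup,
    p.length_support, q.length_support, hp, hq] at h
  lia

lemma Connected.dist_add_dist_add_dist_le [Fintype V] (hG : G.Connected) (u v w : V) :
    G.dist u v + G.dist v w + G.dist u w ≤ 2 * Fintype.card V - 2 := by
  classical
  obtain ⟨m, p, q, hp, hq, hm, hpq⟩ := hG.exists_walks_support_inter_eq u v w
  have hcard := Walk.card_support_union_add_one hp hq hm hpq
  have hle := Finset.card_le_univ (p.support.toFinset ∪ q.support.toFinset)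
  have h₁ := Walk.dist_add_dist_of_mem_support hp hm
  have h₂ := hG.dist_triangle (u := u) (v := m) (w := w)
  have h₃ := hG.dist_triangle (u := v) (v := m) (w := w)
  rw [dist_comm (u := v) (v := m)] at h₃
  lia

lemma Connected.eq_or_eq_of_degree_eq_one_of_dist_add_dist [Fintype (G.neighborSet x)]
    (hG : G.Connected) (hx : G.degree x = 1) (h : G.dist u x + G.dist x v = G.dist u v) :
    x = u ∨ x = v := by
  by_contra! hne
  obtain ⟨y, hy, hyu⟩ := hG.exists_adj_dist_add_one_eq hne.1
  obtain ⟨z, hz, hzv⟩ := hG.exists_adj_dist_add_one_eq hne.2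
  obtain rfl : y = z := (degree_eq_one_iff_existsUnique_adj.1 hx).unique hy hz
  have := hG.dist_triangle (u := u) (v := y) (w := v)
  rw [dist_comm (u := y) (v := u), dist_comm (u := x) (v := u)] at hyu
  lia

lemma Connected.isTree_and_degree_of_dist_add_dist_add_dist_eq [Fintype V] [DecidableRel G.Adj]
    (hG : G.Connected)
    (h : G.dist u v + G.dist v w + G.dist u w = 2 * Fintype.card V - 2) :
    G.IsTree ∧ ∀ x, G.degree x = 1 → x = u ∨ x = v ∨ x = w := by
  classical
  obtain ⟨m, p, q, hp, hq, hm, hpq⟩ := hG.exists_walks_support_inter_eq u v w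
  have hcard := Walk.card_support_union_add_one hp hq hm hpq
  have hle := Finset.card_le_univ (p.support.toFinset ∪ q.support.toFinset)
  have h₁ := Walk.dist_add_dist_of_mem_support hp hm
  have h₂ := hG.dist_triangle (u := u) (v := m) (w := w)
  have h₃ := hG.dist_triangle (u := m) (v := v) (w := w)
  have h₄ := hG.dist_triangle (u := v) (v := m) (w := w)
  rw [dist_comm (u := v) (v := m)] at h₄
  have hn : Fintype.card V = G.dist u v + G.dist m w + 1 := by lia
  have hcover : ∀ x, x ∈ p.support ∨ x ∈ q.support := fun x ↦ by
    have := Finset.mem_univ x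
    rw [← (Finset.card_eq_iff_eq_univ _).1 (hcard.trans hn.symm)] at this
    simpa using this
  have hadj : ∀ x y, G.Adj x y → x ∈ p.support → y ∈ q.support → y ∉ p.support → x = m := by
    intro x y hxy hx hy hyp
    have hym : G.dist m y ≠ 0 := by
      rw [ne_eq, hG.dist_eq_zero_iff]
      rintro rfl
      exact hyp hm
    have e₁ := Walk.dist_add_dist_of_mem_support hp hx
    have e₂ := Walk.dist_add_dist_of_mem_support hq hy
    have e₃ := hG.dist_triangle (u := u) (v := x) (w := w)
    have e₄ := hG.dist_triangle (u := v) (v := x) (w := w)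
    have e₅ := hG.dist_triangle (u := x) (v := y) (w := w)
    rw [dist_eq_one_iff_adj.2 hxy] at e₅
    rw [dist_comm (u := v) (v := x)] at e₄
    have e₆ : G.dist u x = G.dist u m := by lia
    rw [← Walk.getVert_dist_eq_of_mem_support hp hx, e₆,
      Walk.getVert_dist_eq_of_mem_support hp hm]
  have hedge : G.edgeFinset ⊆ p.edges.toFinset ∪ q.edges.toFinset := by
    intro e he
    induction e with | h x y
    rw [mem_edgeFinset, mem_edgeSet] at he
    rw [Finset.mem_union, List.mem_toFinset, List.mem_toFinset]
    by_cases hxp : x ∈ p.support <;> by_cases hyp : y ∈ p.support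
    · exact .inl (Walk.mk_mem_edges_of_adj_of_mem_support hp hxp hyp he)
    · have hyq := (hcover y).resolve_left hyp
      obtain rfl := hadj x y he hxp hyq hyp
      exact .inr (Walk.mk_mem_edges_of_adj_of_mem_support hq q.start_mem_support hyq he)
    · have hxq := (hcover x).resolve_left hxp
      obtain rfl := hadj y x he.symm hyp hxq hxp
      exact .inr (Walk.mk_mem_edges_of_adj_of_mem_support hq hxq q.start_mem_support he)
    · exact .inr (Walk.mk_mem_edges_of_adj_of_mem_support hq ((hcover x).resolve_left hxp)
        ((hcover y).resolve_left hyp) he)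
  refine ⟨isTree_iff_connected_and_card.2 ⟨hG, ?_⟩, fun x hx ↦ ?_⟩
  · have c₁ := (Finset.card_le_card hedge).trans (Finset.card_union_le _ _)
    have c₂ := p.edges.toFinset_card_le
    have c₃ := q.edges.toFinset_card_le
    have c₄ := hG.card_vert_le_card_edgeSet_add_one
    rw [p.length_edges] at c₂
    rw [q.length_edges] at c₃
    rw [edgeFinset_card] at c₁
    rw [Nat.card_eq_fintype_card, Nat.card_eq_fintype_card] at c₄ ⊢
    lia
  · rcases hcover x with hxp | hxq
    · have := hG.eq_or_eq_of_degree_eq_one_of_dist_add_dist hx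
        (Walk.dist_add_dist_of_mem_support hp hxp)
      tauto
    · rcases hG.eq_or_eq_of_degree_eq_one_of_dist_add_dist hx
        (Walk.dist_add_dist_of_mem_support hq hxq) with rfl | rfl
      · have := hG.eq_or_eq_of_degree_eq_one_of_dist_add_dist hx h₁
        tauto
      · tauto

end Connected

namespace IsTree

variable {u v w x y z m : V}

lemma eq_of_adj_of_dist_add_one_eq (hG : G.IsTree) (hxy : G.Adj x y) (hxz : G.Adj x z)
    (hy : G.dist m y + 1 = G.dist m x) (hz : G.dist m z + 1 = G.dist m x) : y = z := by
  obtain ⟨p, hp⟩ := hG.connected.exists_walk_length_eq_dist m y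
  obtain ⟨q, hq⟩ := hG.connected.exists_walk_length_eq_dist m z
  have hp' : (p.concat hxy.symm).IsPath :=
    Walk.isPath_of_length_eq_dist _ (by rw [Walk.length_concat, hp, hy])
  have hq' : (q.concat hxz.symm).IsPath :=
    Walk.isPath_of_length_eq_dist _ (by rw [Walk.length_concat, hq, hz])
  have := congrArg Walk.penultimate ((hG.existsUnique_path m x).unique hp' hq')
  simpa using this

lemma dist_eq_add_of_adj (hG : G.IsTree) (hmy : G.Adj m y)
    (hu : G.dist u y = G.dist u m + 1) (hv : G.dist y v + 1 = G.dist m v) :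
    G.dist u v = G.dist u m + G.dist m v := by
  induction hk : G.dist y v generalizing m y with
  | zero =>
    obtain rfl := hG.connected.dist_eq_zero_iff.1 hk
    lia
  | succ k ih =>
    have hyv : y ≠ v := by
      rintro rfl
      simp at hk
    obtain ⟨z, hyz, hz⟩ := hG.connected.exists_adj_dist_add_one_eq hyv
    rcases hG.dist_eq_dist_add_one_of_adj u hyz with h | h
    · obtain rfl := hG.eq_of_adj_of_dist_add_one_eq (m := u) hyz hmy.symm h.symm hu.symm
      lia
    · have := ih hyz h hz (by lia)
      lia

lemma exists_median (hG : G.IsTree) (u v w : V) :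
    ∃ m, G.dist u v = G.dist m u + G.dist m v ∧ G.dist v w = G.dist m v + G.dist m w ∧
      G.dist u w = G.dist m u + G.dist m w := by
  have hne : (Set.univ : Set V).Nonempty := ⟨u, trivial⟩
  set f : V → ℕ := fun m ↦ G.dist m u + G.dist m v + G.dist m w with hf
  set m := Function.argminOn f Set.univ hne
  have hmin : ∀ y, f m ≤ f y := fun y ↦ Function.argminOn_le f Set.univ (Set.mem_univ y)
  have key : ∀ a b c, (∀ y, G.dist m a + G.dist m b + G.dist m c ≤
      G.dist y a + G.dist y b + G.dist y c) → G.dist a b = G.dist m a + G.dist m b := by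
    intro a b c habc
    by_cases hmb : m = b
    · rw [← hmb, dist_self, add_zero, dist_comm]
    obtain ⟨y, hmy, hy⟩ := hG.connected.exists_adj_dist_add_one_eq hmb
    rcases hG.dist_eq_dist_add_one_of_adj a hmy with h | h
    · have h₁ := habc y
      have h₂ := hG.connected.dist_triangle (u := y) (v := m) (w := c)
      rw [dist_eq_one_iff_adj.2 hmy.symm] at h₂
      rw [dist_comm (u := a) (v := m), dist_comm (u := a) (v := y)] at h
      lia
    · rw [hG.dist_eq_add_of_adj hmy h hy, dist_comm (u := a)]
  refine ⟨m, key u v w fun y ↦ hmin y, key v w u fun y ↦ ?_, key u w v fun y ↦ ?_⟩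
  · have := hmin y
    simp only [hf] at this
    lia
  · have := hmin y
    simp only [hf] at this
    lia

lemma eq_of_dist_eq_of_dist_add_dist (hG : G.IsTree)
    (hx : G.dist m x + G.dist x u = G.dist m u) (hy : G.dist m y + G.dist y u = G.dist m u)
    (hxy : G.dist m x = G.dist m y) : x = y := by
  induction hk : G.dist x u generalizing x y with
  | zero =>
    rw [hG.connected.dist_eq_zero_iff.1 hk]
    exact (hG.connected.dist_eq_zero_iff.1 (by lia)).symm
  | succ k ih =>
    have hxu : x ≠ u := by
      rintro rfl
      simp at hk
    have hyu : y ≠ u := by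
      rintro rfl
      rw [dist_self] at hy
      lia
    obtain ⟨x', hxx, hx'⟩ := hG.connected.exists_adj_dist_add_one_eq hxu
    obtain ⟨y', hyy, hy'⟩ := hG.connected.exists_adj_dist_add_one_eq hyu
    have t₁ := hG.connected.dist_triangle (u := m) (v := x') (w := u)
    have t₂ := hG.connected.dist_triangle (u := m) (v := x) (w := x')
    have t₃ := hG.connected.dist_triangle (u := m) (v := y') (w := u)
    have t₄ := hG.connected.dist_triangle (u := m) (v := y) (w := y')
    rw [dist_eq_one_iff_adj.2 hxx] at t₂
    rw [dist_eq_one_iff_adj.2 hyy] at t₄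
    obtain rfl : x' = y' := ih (by lia) (by lia) (by lia) (by lia)
    exact hG.eq_of_adj_of_dist_add_one_eq (m := m) hxx.symm hyy.symm (by lia) (by lia)

lemma exists_degree_eq_one_dist_add_dist [Fintype V] [DecidableRel G.Adj] [Nontrivial V]
    (hG : G.IsTree) (m x : V) :
    ∃ l, G.degree l = 1 ∧ G.dist m x + G.dist x l = G.dist m l := by
  classical
  obtain ⟨l, hl, hmax⟩ := (Finset.univ.filter fun l ↦
    G.dist m x + G.dist x l = G.dist m l).exists_max_image (fun l ↦ G.dist m l) ⟨x, by simp⟩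
  simp only [Finset.mem_filter, Finset.mem_univ, true_and] at hl hmax
  have hcloser : ∀ y, G.Adj l y → G.dist m y + 1 = G.dist m l := by
    intro y hy
    rcases hG.dist_eq_dist_add_one_of_adj m hy with h | h
    · exact h.symm
    · have t₁ := hG.connected.dist_triangle (u := m) (v := x) (w := y)
      have t₂ := hG.connected.dist_triangle (u := x) (v := l) (w := y)
      rw [dist_eq_one_iff_adj.2 hy] at t₂
      have := hmax y (by lia)
      lia
  refine ⟨l, degree_eq_one_iff_existsUnique_adj.2 ?_, hl⟩
  obtain ⟨y, hy⟩ := hG.connected.preconnected.exists_adj_of_nontrivial l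
  exact ⟨y, hy, fun z hz ↦
    hG.eq_of_adj_of_dist_add_one_eq hz hy (hcloser z hz) (hcloser y hy)⟩

lemma card_filter_ne_dist_add_dist_le [Fintype V] [DecidableEq V] (hG : G.IsTree) (m u : V) :
    (Finset.univ.filter fun x ↦ x ≠ m ∧ G.dist m x + G.dist x u = G.dist m u).card ≤
      G.dist m u := by
  calc _ ≤ (Finset.Icc 1 (G.dist m u)).card := by
        refine Finset.card_le_card_of_injOn (fun x ↦ G.dist m x) (fun x hx ↦ ?_)
          fun x hx y hy hxy ↦ ?_
        · simp only [Finset.coe_filter, Finset.mem_univ, true_and, Set.mem_ofPred_eq] at hx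
          have := hG.connected.pos_dist_of_ne hx.1.symm
          simp only [Finset.coe_Icc, Set.mem_Icc]
          lia
        · simp only [Finset.coe_filter, Finset.mem_univ, true_and, Set.mem_ofPred_eq] at hx hy
          exact hG.eq_of_dist_eq_of_dist_add_dist hx.2 hy.2 hxy
    _ = G.dist m u := by simp

lemma le_dist_add_dist_add_dist [Fintype V] [DecidableRel G.Adj] [Nontrivial V] (hG : G.IsTree)
    (h : ∀ x, G.degree x = 1 → x = u ∨ x = v ∨ x = w) :
    2 * Fintype.card V - 2 ≤ G.dist u v + G.dist v w + G.dist u w := by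
  classical
  obtain ⟨m, h₁, h₂, h₃⟩ := hG.exists_median u v w
  set A : V → Finset V := fun a ↦
    Finset.univ.filter fun x ↦ x ≠ m ∧ G.dist m x + G.dist x a = G.dist m a with hA
  have hcover : (Finset.univ : Finset V) ⊆ {m} ∪ (A u ∪ (A v ∪ A w)) := by
    intro x _
    by_cases hx : x = m
    · simp [hx]
    · obtain ⟨l, hl, hxl⟩ := hG.exists_degree_eq_one_dist_add_dist m x
      simp only [hA, Finset.mem_union, Finset.mem_singleton, Finset.mem_filter,
        Finset.mem_univ, true_and]
      rcases h l hl with rfl | rfl | rfl <;> tauto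
  have hcard := Finset.card_le_card hcover
  have c₁ := Finset.card_union_le {m} (A u ∪ (A v ∪ A w))
  have c₂ := Finset.card_union_le (A u) (A v ∪ A w)
  have c₃ := Finset.card_union_le (A v) (A w)
  have hAu : (A u).card ≤ _ := hG.card_filter_ne_dist_add_dist_le m u
  have hAv : (A v).card ≤ _ := hG.card_filter_ne_dist_add_dist_le m v
  have hAw : (A w).card ≤ _ := hG.card_filter_ne_dist_add_dist_le m w
  rw [Finset.card_univ] at hcard
  rw [Finset.card_singleton] at c₁
  lia

end IsTree

end SimpleGraph

theorem triameter_eq_two_card_sub_two_iff {V : Type*} [Fintype V] [DecidableEq V]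
    (G : SimpleGraph V) [DecidableRel G.Adj]
    (hconn : G.Connected) (hn : 3 ≤ Fintype.card V) :
    G.triameter = 2 * Fintype.card V - 2 ↔
      G.IsTree ∧ (G.numLeaves = 2 ∨ G.numLeaves = 3) := by
  have : Nontrivial V := Fintype.one_lt_card_iff_nontrivial.1 (by lia)
  constructor
  · intro h
    obtain ⟨⟨u, v, w⟩, -, huvw⟩ := Finset.exists_mem_eq_sup (Finset.univ : Finset (V × V × V))
      ⟨(hconn.nonempty.some, hconn.nonempty.some, hconn.nonempty.some), Finset.mem_univ _⟩
      fun p ↦ G.dist p.1 p.2.1 + G.dist p.2.1 p.2.2 + G.dist p.1 p.2.2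
    obtain ⟨htree, hleaf⟩ :=
      hconn.isTree_and_degree_of_dist_add_dist_add_dist_eq (huvw.symm.trans h)
    refine ⟨htree, ?_⟩
    have hle : G.numLeaves ≤ 3 := by
      refine (Finset.card_le_card (t := {u, v, w}) fun x hx ↦ ?_).trans Finset.card_le_three
      simpa using hleaf x (by simpa using hx)
    have hge : 1 < G.numLeaves := by
      obtain ⟨a, b, hab, ha, hb⟩ := htree.exists_ne_and_degree_eq_one
      refine Finset.one_lt_card.2 ⟨a, ?_, b, ?_, hab⟩
      · rw [Finset.mem_filter]
        exact ⟨Finset.mem_univ a, by convert ha⟩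
      · rw [Finset.mem_filter]
        exact ⟨Finset.mem_univ b, by convert hb⟩
    lia
  · rintro ⟨htree, hleaves⟩
    have hleaf : ∃ u v w, ∀ x, G.degree x = 1 → x = u ∨ x = v ∨ x = w := by
      rcases hleaves with h | h
      · obtain ⟨u, v, -, huv⟩ := Finset.card_eq_two.1 h
        refine ⟨u, v, v, fun x hx ↦ ?_⟩
        have : x ∈ ({u, v} : Finset V) := huv ▸ by simpa using hx
        simp only [Finset.mem_insert, Finset.mem_singleton] at this
        tauto
      · obtain ⟨u, v, w, -, -, -, huvw⟩ := Finset.card_eq_three.1 h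
        refine ⟨u, v, w, fun x hx ↦ ?_⟩
        have : x ∈ ({u, v, w} : Finset V) := huvw ▸ by simpa using hx
        simpa using this
    obtain ⟨u, v, w, huvw⟩ := hleaf
    refine le_antisymm (Finset.sup_le fun p _ ↦ hconn.dist_add_dist_add_dist_le _ _ _) ?_
    exact (htree.le_dist_add_dist_add_dist huvw).trans
      (Finset.le_sup (f := fun p : V × V × V ↦
        G.dist p.1 p.2.1 + G.dist p.2.1 p.2.2 + G.dist p.1 p.2.2) (Finset.mem_univ (u, v, w)))
end

section
/- Let G be a finite simple connected graph on n ≥ 3 vertices and let S be a total dominating set of G. Then tr(G) ≤ 4|S|; in particular tr(G) ≤ 4γ_t(G) where γ_t(G) is the total domination number. -/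
open Finset

/-- The total domination number: the minimum size of a total dominating set. -/
noncomputable def SimpleGraph.totalDominationNumber {V : Type*} [Fintype V]
    (G : SimpleGraph V) : ℕ :=
  sInf {k | ∃ S : Finset V, S.card = k ∧ ∀ v : V, ∃ u ∈ S, G.Adj u v}

namespace SimpleGraph

variable {V : Type*} {G T : SimpleGraph V}

theorem Connected.exists_dist_eq_of_le (h : G.Connected) {u w : V} {i : ℕ}
    (hi : i ≤ G.dist w u) :
    ∃ x, G.dist w x = i ∧ G.dist w x + G.dist x u = G.dist w u := by
  obtain ⟨p, hp⟩ := h.exists_walk_length_eq_dist w u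
  have h₁ := dist_le (p.take i)
  have h₂ := dist_le (p.drop i)
  have h₃ := h.dist_triangle (u := w) (v := p.getVert i) (w := u)
  rw [Walk.take_length] at h₁
  rw [Walk.drop_length] at h₂
  exact ⟨p.getVert i, by lia, by lia⟩

theorem IsTree.eq_of_dist_eq (hT : T.IsTree) {w u x y : V}
    (hx : T.dist w x + T.dist x u = T.dist w u) (hy : T.dist w y + T.dist y u = T.dist w u)
    (h : T.dist w x = T.dist w y) : x = y := by
  have key : ∀ z, T.dist w z + T.dist z u = T.dist w u →
      ∃ p : T.Path w u, p.1.getVert (T.dist w z) = z := by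
    intro z hz
    obtain ⟨p, hp⟩ := hT.connected.exists_walk_length_eq_dist w z
    obtain ⟨q, hq⟩ := hT.connected.exists_walk_length_eq_dist z u
    refine ⟨⟨p.append q, Walk.isPath_of_length_eq_dist _ ?_⟩, ?_⟩
    · rw [Walk.length_append]; lia
    · simp [Walk.getVert_append, hp]
  obtain ⟨p, hp⟩ := key x hx
  obtain ⟨q, hq⟩ := key y hy
  rw [← hp, ← hq, (hT.isAcyclic.subsingleton_path w u).elim p q, h]

theorem IsTree.eq_of_adj_of_dist_add_one (hT : T.IsTree) {w s x y : V}
    (hx : T.Adj s x) (hy : T.Adj s y) (hxs : T.dist w x + 1 = T.dist w s)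
    (hys : T.dist w y + 1 = T.dist w s) : x = y :=
  hT.eq_of_dist_eq (w := w) (u := s) (by rwa [dist_eq_one_iff_adj.mpr hx.symm])
    (by rwa [dist_eq_one_iff_adj.mpr hy.symm]) (by lia)

theorem Connected.dist_add_dist_trans (h : G.Connected) {w u s y : V}
    (hy : G.dist w y + G.dist y u = G.dist w u) (hs : G.dist w s + G.dist s y = G.dist w y) :
    G.dist w s + G.dist s u = G.dist w u := by
  have h₁ := h.dist_triangle (u := w) (v := s) (w := u)
  have h₂ := h.dist_triangle (u := s) (v := y) (w := u)
  lia

section Interval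

variable [Fintype V]

open Classical in
/-- The vertices lying on some shortest path from `w` to `u`. -/
noncomputable def geodesicInterval (G : SimpleGraph V) (w u : V) : Finset V :=
  univ.filter fun x => G.dist w x + G.dist x u = G.dist w u

theorem mem_geodesicInterval {w u x : V} :
    x ∈ G.geodesicInterval w u ↔ G.dist w x + G.dist x u = G.dist w u := by
  simp [geodesicInterval]

theorem Connected.dist_add_one_le_card_geodesicInterval (h : G.Connected) (w u : V) :
    G.dist w u + 1 ≤ (G.geodesicInterval w u).card := by
  classical
  rw [← card_range (G.dist w u + 1)]
  refine (card_le_card fun i hi => ?_).trans (card_image_le (f := G.dist w))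
  obtain ⟨x, hx, hxu⟩ := h.exists_dist_eq_of_le (Nat.lt_succ_iff.mp (mem_range.mp hi))
  exact mem_image.mpr ⟨x, mem_geodesicInterval.mpr hxu, hx⟩

open Classical in
/-- In a tree, the subtree spanned by three vertices has at least half their triameter many edges.
The branching vertex `c` is the furthest from `w` that the two intervals share. -/
theorem IsTree.dist_sum_add_two_le (hT : T.IsTree) {w u v c : V}
    (hcu : c ∈ T.geodesicInterval w u) (hcv : c ∈ T.geodesicInterval w v)
    (hmax : ∀ x ∈ T.geodesicInterval w u, x ∈ T.geodesicInterval w v → T.dist w x ≤ T.dist w c) :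
    T.dist w u + T.dist w v + T.dist u v + 2 ≤
      2 * (T.geodesicInterval w u ∪ T.geodesicInterval w v).card := by
  have h₁ := hT.connected.dist_add_one_le_card_geodesicInterval w u
  have h₂ := hT.connected.dist_add_one_le_card_geodesicInterval w v
  have h₃ := card_union_add_card_inter (T.geodesicInterval w u) (T.geodesicInterval w v)
  have h₄ : (T.geodesicInterval w u ∩ T.geodesicInterval w v).card ≤ T.dist w c + 1 := by
    rw [← card_range (T.dist w c + 1)]
    refine card_le_card_of_injOn (T.dist w) (fun x hx => ?_) fun x hx y hy hxy => ?_
    · have hx := mem_inter.mp hx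
      exact mem_coe.mpr (mem_range.mpr (Nat.lt_succ_of_le (hmax x hx.1 hx.2)))
    · exact hT.eq_of_dist_eq (mem_geodesicInterval.mp (mem_inter.mp hx).1)
        (mem_geodesicInterval.mp (mem_inter.mp hy).1) hxy
  have h₅ := hT.connected.dist_triangle (u := u) (v := c) (w := v)
  rw [dist_comm (u := u) (v := c)] at h₅
  rw [mem_geodesicInterval] at hcu hcv
  lia

open Classical in
theorem IsTree.card_neighbors_le (hT : T.IsTree) {w u v c : V}
    (hcu : c ∈ T.geodesicInterval w u) (hcv : c ∈ T.geodesicInterval w v)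
    (hmax : ∀ x ∈ T.geodesicInterval w u, x ∈ T.geodesicInterval w v → T.dist w x ≤ T.dist w c)
    (s : V) :
    ((T.geodesicInterval w u ∪ T.geodesicInterval w v).filter (T.Adj s)).card ≤
      2 + if s = c then 1 else 0 := by
  have step : ∀ {a y}, y ∈ T.geodesicInterval w a → T.Adj s y → T.dist w y = T.dist w s + 1 →
      s ∈ T.geodesicInterval w a := by
    intro a y hy hsy hd
    rw [mem_geodesicInterval] at hy ⊢
    refine hT.connected.dist_add_dist_trans hy ?_
    rw [dist_eq_one_iff_adj.mpr hsy, hd]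
  have inj : ∀ {a x y}, x ∈ T.geodesicInterval w a → y ∈ T.geodesicInterval w a →
      T.dist w x = T.dist w s + 1 → T.dist w y = T.dist w s + 1 → x = y := fun hx hy h₁ h₂ =>
    hT.eq_of_dist_eq (mem_geodesicInterval.mp hx) (mem_geodesicInterval.mp hy) (h₁.trans h₂.symm)
  let A := univ.filter fun y => T.Adj s y ∧ T.dist w y + 1 = T.dist w s
  let B := fun a => (T.geodesicInterval w a).filter
    fun y => T.Adj s y ∧ T.dist w y = T.dist w s + 1
  have hA : A.card ≤ 1 := card_le_one.mpr fun x hx y hy => by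
    simp only [A, mem_filter] at hx hy
    exact hT.eq_of_adj_of_dist_add_one hx.2.1 hy.2.1 hx.2.2 hy.2.2
  have hB : ∀ a, (B a).card ≤ 1 := fun a => card_le_one.mpr fun x hx y hy => by
    simp only [B, mem_filter] at hx hy
    exact inj hx.1 hy.1 hx.2.2 hy.2.2
  have hsub : (T.geodesicInterval w u ∪ T.geodesicInterval w v).filter (T.Adj s) ⊆
      A ∪ (B u ∪ B v) := by
    intro y hy
    simp only [mem_filter, mem_union] at hy
    have := hT.dist_eq_dist_add_one_of_adj w hy.2
    simp only [A, B, mem_union, mem_filter, mem_univ, true_and]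
    grind
  have hle := (card_le_card hsub).trans (card_union_le _ _)
  have hBB := card_union_le (B u) (B v)
  have hBu := hB u
  have hBv := hB v
  split_ifs with hsc
  · lia
  suffices (B u ∪ B v).card ≤ 1 by lia
  have shared : ∀ x ∈ B u, ∀ y ∈ B v, x = y := by
    intro x hx y hy
    simp only [B, mem_filter] at hx hy
    have hsu := step hx.1 hx.2.1 hx.2.2
    have hsv := step hy.1 hy.2.1 hy.2.2
    have hlt : T.dist w s + 1 ≤ T.dist w c := by
      refine Nat.succ_le_of_lt (lt_of_le_of_ne (hmax s hsu hsv) fun he => hsc ?_)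
      exact hT.eq_of_dist_eq (mem_geodesicInterval.mp hsu) (mem_geodesicInterval.mp hcu) he
    obtain ⟨z, hz, hzc⟩ := hT.connected.exists_dist_eq_of_le hlt
    have hzI : ∀ {a}, c ∈ T.geodesicInterval w a → z ∈ T.geodesicInterval w a := fun hc =>
      mem_geodesicInterval.mpr
        (hT.connected.dist_add_dist_trans (mem_geodesicInterval.mp hc) hzc)
    exact (inj hx.1 (hzI hcu) hx.2.2 hz).trans (inj (hzI hcv) hy.1 hz hy.2.2)
  refine card_le_one.mpr fun x hx y hy => ?_
  rcases mem_union.mp hx with hx | hx <;> rcases mem_union.mp hy with hy | hy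
  · exact card_le_one.mp hBu x hx y hy
  · exact shared x hx y hy
  · exact (shared y hy x hx).symm
  · exact card_le_one.mp hBv x hx y hy

theorem IsTree.dist_sum_le_four_mul_card (hT : T.IsTree) (S : Finset V)
    (hS : ∀ v, ∃ u ∈ S, T.Adj u v) (w u v : V) :
    T.dist w u + T.dist w v + T.dist u v ≤ 4 * S.card := by
  classical
  obtain ⟨c, hc, hmax⟩ := exists_max_image (T.geodesicInterval w u ∩ T.geodesicInterval w v)
    (T.dist w) ⟨w, by simp [mem_geodesicInterval]⟩
  obtain ⟨hcu, hcv⟩ := mem_inter.mp hc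
  have hmax : ∀ x ∈ T.geodesicInterval w u, x ∈ T.geodesicInterval w v →
      T.dist w x ≤ T.dist w c := fun x hx hx' => hmax x (mem_inter.mpr ⟨hx, hx'⟩)
  have hlow := hT.dist_sum_add_two_le hcu hcv hmax
  set H := T.geodesicInterval w u ∪ T.geodesicInterval w v with hH
  have hup : H.card ≤ 2 * S.card + 1 := calc
    H.card ≤ (S.biUnion fun s => H.filter (T.Adj s)).card := card_le_card fun y hy => by
      obtain ⟨s, hs, hsy⟩ := hS y
      exact mem_biUnion.mpr ⟨s, hs, mem_filter.mpr ⟨hy, hsy⟩⟩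
    _ ≤ ∑ s ∈ S, (H.filter (T.Adj s)).card := card_biUnion_le
    _ ≤ ∑ s ∈ S, (2 + if s = c then 1 else 0) :=
      sum_le_sum fun s _ => hT.card_neighbors_le hcu hcv hmax s
    _ ≤ 2 * S.card + 1 := by
      rw [sum_add_distrib, sum_const, smul_eq_mul, mul_comm, sum_ite_eq']
      split_ifs <;> lia
  lia

end Interval

theorem exists_adj_of_reachable_eq {F : SimpleGraph V} (h : F.Reachable = G.Reachable) {u v : V}
    (huv : G.Adj v u) : ∃ x, F.Adj v x := by
  have hr : F.Reachable v u := h ▸ huv.reachable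
  obtain ⟨p⟩ := hr
  cases p with
  | nil => exact (huv.ne rfl).elim
  | cons hx _ => exact ⟨_, hx⟩

/-- A total dominating set of a connected graph is one of some spanning tree: first take a spanning
forest of the edges inside `S`, extend it inside the edges meeting `S`, and then to a tree. -/
theorem Connected.exists_isTree_totalDominating (h : G.Connected) (S : Set V)
    (hS : ∀ v, ∃ u ∈ S, G.Adj u v) : ∃ T ≤ G, T.IsTree ∧ ∀ v, ∃ u ∈ S, T.Adj u v := by
  let G₁ : SimpleGraph V := G ⊓ fromRel fun a b => a ∈ S ∧ b ∈ S
  let G₂ : SimpleGraph V := G ⊓ fromRel fun a b => a ∈ S ∨ b ∈ S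
  have h₁₂ : G₁ ≤ G₂ := by
    intro a b hab
    simp only [G₁, G₂, inf_adj, fromRel_adj] at hab ⊢
    tauto
  obtain ⟨F₁, hF₁, hF₁a, hF₁r⟩ := G₁.exists_isAcyclic_reachable_eq_le
  obtain ⟨F₂, hF₁₂, hF₂, hF₂a, hF₂r⟩ :=
    exists_isAcyclic_reachable_eq_le_of_le_of_isAcyclic (hF₁.trans h₁₂) hF₁a
  obtain ⟨T, hF₂T, hTG, hT⟩ :=
    h.exists_isTree_le_of_le_of_isAcyclic (hF₂.trans inf_le_left) hF₂a
  refine ⟨T, hTG, hT, fun v => ?_⟩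
  obtain ⟨u, hu, huv⟩ := hS v
  by_cases hv : v ∈ S
  · obtain ⟨x, hx⟩ := exists_adj_of_reachable_eq hF₁r (u := u) (v := v) (by
      simp only [G₁, inf_adj, fromRel_adj]
      exact ⟨huv.symm, huv.ne.symm, Or.inl ⟨hv, hu⟩⟩)
    have hx' := hF₁ hx
    simp only [G₁, inf_adj, fromRel_adj] at hx'
    exact ⟨x, by tauto, (hF₂T (hF₁₂ hx)).symm⟩
  · obtain ⟨x, hx⟩ := exists_adj_of_reachable_eq hF₂r (u := u) (v := v) (by
      simp only [G₂, inf_adj, fromRel_adj]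
      exact ⟨huv.symm, huv.ne.symm, Or.inl (Or.inr hu)⟩)
    have hx' := hF₂ hx
    simp only [G₂, inf_adj, fromRel_adj] at hx'
    exact ⟨x, by tauto, (hF₂T hx).symm⟩

theorem Connected.triameter_le_four_mul_card [Fintype V] (h : G.Connected) (S : Finset V)
    (hS : ∀ v, ∃ u ∈ S, G.Adj u v) : G.triameter ≤ 4 * S.card := by
  obtain ⟨T, hTG, hT, hTS⟩ := h.exists_isTree_totalDominating (S : Set V) hS
  have hd (a b : V) : G.dist a b ≤ T.dist a b := (hT.connected a b).dist_anti hTG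
  refine Finset.sup_le fun p _ => ?_
  have hsum := hT.dist_sum_le_four_mul_card S hTS p.1 p.2.1 p.2.2
  have h₁ := hd p.1 p.2.1
  have h₂ := hd p.2.1 p.2.2
  have h₃ := hd p.1 p.2.2
  lia

end SimpleGraph

theorem triameter_le_four_total_domination {V : Type*} [Fintype V]
    (G : SimpleGraph V) (hconn : G.Connected) (hn : 3 ≤ Fintype.card V)
    (S : Finset V) (hdom : ∀ v : V, ∃ u ∈ S, G.Adj u v) :
    G.triameter ≤ 4 * S.card ∧ G.triameter ≤ 4 * G.totalDominationNumber := by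
  refine ⟨hconn.triameter_le_four_mul_card S hdom, ?_⟩
  obtain ⟨D, hD, hDdom⟩ :=
    Nat.sInf_mem (s := {k | ∃ S : Finset V, S.card = k ∧ ∀ v : V, ∃ u ∈ S, G.Adj u v})
      ⟨S.card, S, rfl, hdom⟩
  rw [SimpleGraph.totalDominationNumber, ← hD]
  exact hconn.triameter_le_four_mul_card D hDdom
end

section
/- Let G be a finite simple connected graph on n ≥ 3 vertices that contains at least one cycle. Then the girth of G satisfies g(G) ≤ tr(G). -/
open Finset

namespace SimpleGraph

variable {V : Type*} {G : SimpleGraph V}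

/-- A path whose length is at most half the girth is a geodesic. -/
lemma Walk.IsPath.length_le_dist_of_two_mul_length_le_girth {u v : V} {p : G.Walk u v}
    (hp : p.IsPath) (h : 2 * p.length ≤ G.girth) : p.length ≤ G.dist u v := by
  by_contra! hlt
  obtain ⟨q, hq, hqd⟩ := p.reachable.exists_path_of_dist
  have hne : p ≠ q := by
    rintro rfl
    omega
  obtain ⟨_, _, p', q', hp', hq', hc⟩ := hp.exists_isCycle_of_ne hq hne
  have hg := girth_le_length hc
  obtain ⟨_, _, rfl⟩ := hp'
  obtain ⟨_, _, rfl⟩ := hq'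
  simp only [Walk.length_append, Walk.length_reverse] at *
  omega

lemma dist_add_dist_add_dist_le_triameter [Fintype V] (u v w : V) :
    G.dist u v + G.dist v w + G.dist u w ≤ G.triameter :=
  Finset.le_sup (f := fun p : V × V × V =>
    G.dist p.1 p.2.1 + G.dist p.2.1 p.2.2 + G.dist p.1 p.2.2) (Finset.mem_univ (u, v, w))

end SimpleGraph

theorem girth_le_triameter {V : Type*} [Fintype V] (G : SimpleGraph V)
    (hconn : G.Connected) (hn : 3 ≤ Fintype.card V) (hcyc : ¬ G.IsAcyclic) :
    G.girth ≤ G.triameter := by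
  obtain ⟨u, c, hc, hg⟩ := SimpleGraph.exists_girth_eq_length.mpr hcyc
  have hg3 := SimpleGraph.three_le_girth hcyc
  obtain ⟨i, j, hij, hj, hj0, hi2, hij2, hj2⟩ : ∃ i j : ℕ, i ≤ j ∧ j < G.girth ∧ 0 < j ∧
      2 * i ≤ G.girth ∧ 2 * (j - i) ≤ G.girth ∧ 2 * (G.girth - j) ≤ G.girth :=
    ⟨G.girth / 3, G.girth / 3 + (G.girth - G.girth / 3) / 2, by omega⟩
  have hpath : (c.take j).IsPath := hc.isPath_take (by omega)
  have h₁ := (hpath.take i).length_le_dist_of_two_mul_length_le_girth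
    (by simp only [SimpleGraph.Walk.take_length]; omega)
  have h₂ := (hpath.drop i).length_le_dist_of_two_mul_length_le_girth
    (by simp only [SimpleGraph.Walk.take_length, SimpleGraph.Walk.drop_length]; omega)
  have h₃ := (hc.isPath_drop hj0).length_le_dist_of_two_mul_length_le_girth
    (by simp only [SimpleGraph.Walk.drop_length]; omega)
  have h := G.dist_add_dist_add_dist_le_triameter u ((c.take j).getVert i) (c.getVert j)
  rw [SimpleGraph.dist_comm] at h₃
  simp only [SimpleGraph.Walk.take_length, SimpleGraph.Walk.drop_length] at h₁ h₂ h₃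
  omega
end

section
/- Let G be a finite simple graph on n ≥ 4 vertices such that both G and its complement Ḡ are connected. Then 10 ≤ tr(G) + tr(Ḡ) ≤ 2n + 4. -/
open Finset

namespace SimpleGraph

variable {V : Type*} {G : SimpleGraph V}

theorem compl_dist_le_one_of_not_adj {x y : V} (h : ¬G.Adj x y) : Gᶜ.dist x y ≤ 1 := by
  by_cases hxy : x = y
  · simp [hxy]
  · exact (dist_eq_one_iff_adj.2 ((compl_adj G x y).2 ⟨hxy, h⟩)).le

theorem not_adj_of_two_le_dist {u v : V} (h : 2 ≤ G.dist u v) : ¬G.Adj u v := fun hadj => by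
  have := dist_eq_one_iff_adj.2 hadj
  omega

theorem Connected.compl_dist_le_two (hc : Gᶜ.Connected) {x y z : V}
    (hx : ¬G.Adj z x) (hy : ¬G.Adj z y) : Gᶜ.dist x y ≤ 2 := by
  have h := hc.dist_triangle (u := x) (v := z) (w := y)
  have h₁ := compl_dist_le_one_of_not_adj hx
  have h₂ := compl_dist_le_one_of_not_adj hy
  rw [dist_comm] at h₁
  omega

theorem Connected.not_adj_or_not_adj_of_three_le_dist (hG : G.Connected) {u v : V}
    (h : 3 ≤ G.dist u v) (x : V) : ¬G.Adj u x ∨ ¬G.Adj v x := by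
  by_contra! hx
  have h₁ := dist_eq_one_iff_adj.2 hx.1
  have h₂ := dist_eq_one_iff_adj.2 hx.2.symm
  have := hG.dist_triangle (u := u) (v := x) (w := v)
  omega

theorem Connected.compl_dist_le_two_of_four_le_dist (hG : G.Connected) (hc : Gᶜ.Connected)
    {u v : V} (h : 4 ≤ G.dist u v) (x y : V) : Gᶜ.dist x y ≤ 2 := by
  have hle (a b : V) (ha : G.Adj u a) (hb : G.Adj v b) : ¬G.Adj a b := fun hab => by
    have h₁ := dist_eq_one_iff_adj.2 ha
    have h₂ := dist_eq_one_iff_adj.2 hb.symm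
    have h₃ := dist_eq_one_iff_adj.2 hab
    have h₄ := hG.dist_triangle (u := u) (v := a) (w := v)
    have h₅ := hG.dist_triangle (u := a) (v := b) (w := v)
    omega
  have hx := hG.not_adj_or_not_adj_of_three_le_dist (by omega : 3 ≤ G.dist u v) x
  have hy := hG.not_adj_or_not_adj_of_three_le_dist (by omega : 3 ≤ G.dist u v) y
  by_cases hux : G.Adj u x
  · have hvx : ¬G.Adj v x := by tauto
    by_cases hvy : G.Adj v y
    · exact (compl_dist_le_one_of_not_adj (hle x y hux hvy)).trans one_le_two
    · exact hc.compl_dist_le_two hvx hvy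
  · by_cases huy : G.Adj u y
    · by_cases hvx : G.Adj v x
      · rw [dist_comm]
        exact (compl_dist_le_one_of_not_adj (hle y x huy hvx)).trans one_le_two
      · exact hc.compl_dist_le_two hvx (by tauto)
    · exact hc.compl_dist_le_two hux huy

theorem Connected.compl_dist_le_two_of_three_le_dist (hG : G.Connected) (hc : Gᶜ.Connected)
    {u v w : V} (huv : 3 ≤ G.dist u v) (hvw : 3 ≤ G.dist v w) (huw : 3 ≤ G.dist u w)
    (x y : V) : Gᶜ.dist x y ≤ 2 := by
  have h₁ := hG.not_adj_or_not_adj_of_three_le_dist huv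
  have h₂ := hG.not_adj_or_not_adj_of_three_le_dist hvw
  have h₃ := hG.not_adj_or_not_adj_of_three_le_dist huw
  obtain ⟨z, hx, hy⟩ : ∃ z, ¬G.Adj z x ∧ ¬G.Adj z y := by
    by_contra! h
    rcases or_iff_not_imp_left.2 (h u), or_iff_not_imp_left.2 (h v), or_iff_not_imp_left.2 (h w)
      with ⟨hu | hu, hv | hv, hw | hw⟩ <;> grind
  exact hc.compl_dist_le_two hx hy

theorem Connected.exists_adj_adj_ne [Fintype V] (hG : G.Connected) (hn : 3 ≤ Fintype.card V) :
    ∃ u v w, G.Adj u v ∧ G.Adj v w ∧ u ≠ w := by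
  classical
  have : Nontrivial V := Fintype.one_lt_card_iff_nontrivial.1 (by omega)
  obtain ⟨u⟩ := hG.nonempty
  obtain ⟨v, huv⟩ := hG.preconnected.exists_adj_of_nontrivial u
  obtain ⟨z, hz⟩ : ∃ z, z ∉ ({u, v} : Finset V) := by
    by_contra! h
    have := (Finset.card_le_card (fun z _ => h z : (univ : Finset V) ⊆ {u, v})).trans
      Finset.card_le_two
    rw [Finset.card_univ] at this
    omega
  obtain ⟨p⟩ := hG.preconnected u z
  obtain ⟨d, -, hd, hd'⟩ := p.exists_boundary_dart ({u, v} : Set V) (by simp) (by simpa using hz)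
  simp only [Set.mem_insert_iff, Set.mem_singleton_iff, not_or] at hd hd'
  have hadj := d.adj
  rcases hd with h | h <;> rw [h] at hadj
  · exact ⟨v, u, d.snd, huv.symm, hadj, Ne.symm hd'.2⟩
  · exact ⟨u, v, d.snd, huv, hadj, Ne.symm hd'.1⟩

variable [Fintype V]

theorem le_triameter (G : SimpleGraph V) (u v w : V) :
    G.dist u v + G.dist v w + G.dist u w ≤ G.triameter :=
  Finset.le_sup (f := fun p : V × V × V =>
    G.dist p.1 p.2.1 + G.dist p.2.1 p.2.2 + G.dist p.1 p.2.2) (Finset.mem_univ (u, v, w))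

theorem triameter_le_iff {k : ℕ} :
    G.triameter ≤ k ↔ ∀ u v w, G.dist u v + G.dist v w + G.dist u w ≤ k := by
  simp [triameter]

theorem triameter_le_six_of_dist_le_two (h : ∀ x y, G.dist x y ≤ 2) : G.triameter ≤ 6 :=
  triameter_le_iff.2 fun u v w => by
    have := h u v
    have := h v w
    have := h u w
    omega

theorem Connected.five_le_triameter (hG : G.Connected) (hc : Gᶜ.Connected)
    (hn : 3 ≤ Fintype.card V) : 5 ≤ G.triameter := by
  obtain ⟨u, v, w, huv, hvw, huw⟩ := hc.exists_adj_adj_ne hn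
  have h₁ := hG.one_lt_dist_of_ne_of_not_adj huv.ne ((compl_adj G u v).1 huv).2
  have h₂ := hG.one_lt_dist_of_ne_of_not_adj hvw.ne ((compl_adj G v w).1 hvw).2
  have h₃ := hG.pos_dist_of_ne huw
  have := G.le_triameter u v w
  omega

/-- A shortest path from `u` to `v` and a shortest path from `w` to it share only one vertex, which
bounds the sum of their lengths by the number of vertices. -/
theorem Connected.triameter_add_two_le (hG : G.Connected) :
    G.triameter + 2 ≤ 2 * Fintype.card V := by
  classical
  have := hG.nonempty
  have hpos := Fintype.card_pos (α := V)
  suffices G.triameter ≤ 2 * Fintype.card V - 2 by omega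
  refine triameter_le_iff.2 fun u v w => ?_
  obtain ⟨p, hp, hpl⟩ := hG.exists_path_of_dist u v
  obtain ⟨m, hm, hmin⟩ := p.support.toFinset.exists_min_image (G.dist w) ⟨u, by simp⟩
  obtain ⟨q, hq, hql⟩ := hG.exists_path_of_dist w m
  rw [List.mem_toFinset] at hm
  have hinter : p.support.toFinset ∩ q.support.toFinset ⊆ {m} := fun x hx => by
    simp only [Finset.mem_inter, List.mem_toFinset, Finset.mem_singleton] at hx ⊢
    by_contra hxm
    have h₁ := Walk.length_takeUntil_lt_length hx.2 hxm
    have h₂ := dist_le (q.takeUntil x hx.2)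
    have h₃ := hmin x (by simpa using hx.1)
    omega
  have hcard := Finset.card_union_add_card_inter p.support.toFinset q.support.toFinset
  have hi := Finset.card_le_card hinter
  have hu := Finset.card_le_univ (p.support.toFinset ∪ q.support.toFinset)
  rw [List.toFinset_card_of_nodup hp.support_nodup, List.toFinset_card_of_nodup hq.support_nodup,
    Walk.length_support, Walk.length_support] at hcard
  rw [Finset.card_singleton] at hi
  have hlen := congrArg Walk.length (p.take_spec hm)
  rw [Walk.length_append] at hlen
  have hum := dist_le (p.takeUntil m hm)
  have hmv := dist_le (p.dropUntil m hm)
  have huw := hG.dist_triangle (u := u) (v := m) (w := w)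
  have hvw := hG.dist_triangle (u := v) (v := m) (w := w)
  rw [dist_comm (u := m) (v := w)] at huw hvw
  rw [dist_comm (u := v) (v := m)] at hvw
  omega

theorem Connected.compl_triameter_le_six_of_nine_le (hG : G.Connected) (hc : Gᶜ.Connected)
    (h : 9 ≤ G.triameter) : Gᶜ.triameter ≤ 6 := by
  refine triameter_le_six_of_dist_le_two fun x y => ?_
  by_contra hxy
  have h₃ (u v : V) : G.dist u v ≤ 3 := by
    by_contra huv
    exact hxy (hG.compl_dist_le_two_of_four_le_dist hc (by omega : 4 ≤ G.dist u v) x y)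
  suffices G.triameter ≤ 8 by omega
  refine triameter_le_iff.2 fun u v w => ?_
  by_contra huvw
  have := h₃ u v
  have := h₃ v w
  have := h₃ u w
  exact hxy (hG.compl_dist_le_two_of_three_le_dist hc (u := u) (v := v) (w := w)
    (by omega) (by omega) (by omega) x y)

theorem Connected.compl_triameter_le_six_of_dist (hG : G.Connected) (hc : Gᶜ.Connected)
    (hn : Fintype.card V = 5) {u v w : V} (huv : 3 ≤ G.dist u v) (huw : 3 ≤ G.dist u w)
    (hvw : 2 ≤ G.dist v w) : Gᶜ.triameter ≤ 6 := by
  classical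
  have huv' : u ≠ v := by rintro rfl; simp at huv
  have huw' : u ≠ w := by rintro rfl; simp at huw
  have hvw' : v ≠ w := by rintro rfl; simp at hvw
  obtain ⟨x, y, -, hxy⟩ : ∃ x y, x ≠ y ∧ ({u, v, w} : Finset V)ᶜ = {x, y} := by
    rw [← Finset.card_eq_two, Finset.card_compl, hn, Finset.card_eq_three.2 ⟨u, v, w, by simp [*]⟩]
  have hall (z : V) : z = u ∨ z = v ∨ z = w ∨ z = x ∨ z = y := by
    have := congrArg (z ∈ ·) hxy
    simp only [Finset.mem_compl, Finset.mem_insert, Finset.mem_singleton, eq_iff_iff] at this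
    tauto
  have huv₁ := compl_dist_le_one_of_not_adj (not_adj_of_two_le_dist (by omega : 2 ≤ G.dist u v))
  have huw₁ := compl_dist_le_one_of_not_adj (not_adj_of_two_le_dist (by omega : 2 ≤ G.dist u w))
  have hvw₁ := compl_dist_le_one_of_not_adj (not_adj_of_two_le_dist hvw)
  have hside (z : V) : Gᶜ.dist u z ≤ 1 ∨ Gᶜ.dist v z ≤ 1 ∧ Gᶜ.dist w z ≤ 1 := by
    by_cases hz : G.Adj u z
    · have h₁ := hG.not_adj_or_not_adj_of_three_le_dist huv z
      have h₂ := hG.not_adj_or_not_adj_of_three_le_dist huw z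
      exact .inr ⟨compl_dist_le_one_of_not_adj (by tauto),
        compl_dist_le_one_of_not_adj (by tauto)⟩
    · exact .inl (compl_dist_le_one_of_not_adj hz)
  have tri (a b c : V) := hc.dist_triangle (u := a) (v := b) (w := c)
  have comm (a b : V) : Gᶜ.dist a b = Gᶜ.dist b a := dist_comm
  have self (a : V) : Gᶜ.dist a a = 0 := dist_self
  have := hside x
  have := hside y
  have := tri u v x
  have := tri v u x
  have := tri w u x
  have := tri u v y
  have := tri v u y
  have := tri w u y
  have := tri x u y
  have := tri x v y
  have := comm u v
  have := comm u w
  have := comm u x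
  have := comm u y
  have := comm v w
  have := comm v x
  have := comm v y
  have := comm w x
  have := comm w y
  have := comm x y
  have := self u
  have := self v
  have := self w
  have := self x
  have := self y
  refine triameter_le_iff.2 fun a b c => ?_
  rcases hall a with ha | ha | ha | ha | ha <;>
  rcases hall b with hb | hb | hb | hb | hb <;>
  rcases hall c with hc | hc | hc | hc | hc <;> rw [ha, hb, hc] <;> omega

theorem Connected.compl_triameter_le_six_of_eight_le (hG : G.Connected) (hc : Gᶜ.Connected)
    (hn : Fintype.card V = 5) (h : 8 ≤ G.triameter) : Gᶜ.triameter ≤ 6 := by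
  by_contra hlt
  have h₃ (u v : V) : G.dist u v ≤ 3 := by
    by_contra huv
    exact hlt (triameter_le_six_of_dist_le_two
      (hG.compl_dist_le_two_of_four_le_dist hc (by omega : 4 ≤ G.dist u v)))
  suffices G.triameter ≤ 7 by omega
  refine triameter_le_iff.2 fun u v w => ?_
  by_contra huvw
  have := h₃ u v
  have := h₃ v w
  have := h₃ u w
  have key {a b c : V} (hab : 3 ≤ G.dist a b) (hac : 3 ≤ G.dist a c) (hbc : 2 ≤ G.dist b c) :=
    hlt (hG.compl_triameter_le_six_of_dist hc hn hab hac hbc)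
  have := dist_comm (G := G) (u := u) (v := v)
  have := dist_comm (G := G) (u := u) (v := w)
  have := dist_comm (G := G) (u := v) (v := w)
  rcases (by omega : G.dist u v = 2 ∨ G.dist u w = 2 ∨ G.dist u v = 3 ∧ G.dist u w = 3)
    with h | h | h
  · exact key (a := w) (b := u) (c := v) (by omega) (by omega) (by omega)
  · exact key (a := v) (b := u) (c := w) (by omega) (by omega) (by omega)
  · exact key (a := u) (b := v) (c := w) (by omega) (by omega) (by omega)

end SimpleGraph

theorem nordhaus_gaddum_triameter {V : Type*} [Fintype V] (G : SimpleGraph V)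
    (hn : 4 ≤ Fintype.card V) (hconn : G.Connected) (hconnc : Gᶜ.Connected) :
    10 ≤ G.triameter + Gᶜ.triameter ∧
      G.triameter + Gᶜ.triameter ≤ 2 * Fintype.card V + 4 := by
  have hc : Gᶜᶜ = G := compl_compl G
  have hconn' : Gᶜᶜ.Connected := hc.symm ▸ hconn
  have h₁ := hconn.five_le_triameter hconnc (by omega)
  have h₂ := hconnc.five_le_triameter hconn' (by omega)
  have h₃ := hconn.triameter_add_two_le
  have h₄ := hconnc.triameter_add_two_le
  have h₅ := hconn.compl_triameter_le_six_of_nine_le hconnc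
  have h₆ := hconnc.compl_triameter_le_six_of_nine_le hconn'
  have h₇ := hconn.compl_triameter_le_six_of_eight_le hconnc
  have h₈ := hconnc.compl_triameter_le_six_of_eight_le hconn'
  rw [hc] at h₆ h₈
  omega
end
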